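/- Let S and A be nonempty measurable spaces, r : S × A → ℝ, γ ∈ (0,1), and κ a Markov kernel from S × A to S. Let α, β ∈ [0,1], U ⊆ S × A, and H : S × A → ℝ with H(x) > 0 for every x ∈ U. Let Q : S × A → ℝ be bounded by M, suppose that for every (s,a) the functions s' ↦ ⨆_{a' ∈ A} Q(s',a') and s' ↦ ⨆_{a' ∈ A} G_Q(s',a') are integrable with respect to κ(s,a), and assume the event hypothesis: for every x ∈ U, |1 − 1/H(x)|·|Q(x)| ≤ (1−β)·⨆_{y} |Q(y)|. Then for every (s,a): |Q(s,a) − 𝓕Q(s,a)| ≤ |Q(s,a) − 𝓑Q(s,a)| + γ·(1−α)·(1−β)·⨆_{x ∈ S×A} |Q(x)|. -/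

import Mathlib

open MeasureTheory ProbabilityTheory

open Classical in
/-- The blended (uncertainty-penalized) target of QDQ: on the high-uncertainty set `U` the
Q-value is weighted by `1/H`, and off `U` it is weighted by `β`, mixed with the unpenalized
value with weight `α`. -/
noncomputable def blendedTarget {X : Type*} (U : Set X) (H : X → ℝ) (α β : ℝ)
    (Q : X → ℝ) (x : X) : ℝ :=
  α * Q x + (1 - α) * (if x ∈ U then Q x / H x else β * Q x)

/-- The QDQ Bellman operator
`(𝓕Q)(s,a) = r(s,a) + γ ∫ (⨆ a', G_Q(s',a')) dκ(s,a)(s')`, where `G_Q` is the blended target. -/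
noncomputable def qdqBellman {S A : Type*} [MeasurableSpace S] [MeasurableSpace A]
    (r : S × A → ℝ) (γ : ℝ) (κ : Kernel (S × A) S) (U : Set (S × A)) (H : S × A → ℝ)
    (α β : ℝ) (Q : S × A → ℝ) (p : S × A) : ℝ :=
  r p + γ * ∫ s', (⨆ a' : A, blendedTarget U H α β Q (s', a')) ∂(κ p)

/-- The classical (optimal) Bellman operator
`(𝓑Q)(s,a) = r(s,a) + γ ∫ (⨆ a', Q(s',a')) dκ(s,a)(s')`. -/
noncomputable def classicalBellman {S A : Type*} [MeasurableSpace S] [MeasurableSpace A]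
    (r : S × A → ℝ) (γ : ℝ) (κ : Kernel (S × A) S) (Q : S × A → ℝ) (p : S × A) : ℝ :=
  r p + γ * ∫ s', (⨆ a' : A, Q (s', a')) ∂(κ p)

/-- The blended target stays within `(1 - α) * C` of `Q` wherever each of the two penalties
changes `Q` by at most `C`. -/
theorem abs_blendedTarget_sub_le {X : Type*} {U : Set X} {H Q : X → ℝ} {α β C : ℝ} {x : X}
    (hα : α ≤ 1) (hU : x ∈ U → |1 - 1 / H x| * |Q x| ≤ C) (hUc : |1 - β| * |Q x| ≤ C) :
    |blendedTarget U H α β Q x - Q x| ≤ (1 - α) * C := by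
  have hα' : 0 ≤ 1 - α := sub_nonneg.2 hα
  unfold blendedTarget
  split_ifs with hx
  · rw [show α * Q x + (1 - α) * (Q x / H x) - Q x = -((1 - α) * ((1 - 1 / H x) * Q x)) by ring,
      abs_neg, abs_mul, abs_of_nonneg hα', abs_mul]
    exact mul_le_mul_of_nonneg_left (hU hx) hα'
  · rw [show α * Q x + (1 - α) * (β * Q x) - Q x = -((1 - α) * ((1 - β) * Q x)) by ring,
      abs_neg, abs_mul, abs_of_nonneg hα', abs_mul]
    exact mul_le_mul_of_nonneg_left hUc hα'

theorem abs_ciSup_sub_ciSup_le {ι : Type*} [Nonempty ι] {f g : ι → ℝ} {C : ℝ}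
    (hg : BddAbove (Set.range g)) (h : ∀ i, |f i - g i| ≤ C) :
    |(⨆ i, f i) - ⨆ i, g i| ≤ C := by
  have hfg (i : ι) : f i ≤ (⨆ j, g j) + C := by
    linarith [le_ciSup hg i, (abs_le.1 (h i)).2]
  have hf : BddAbove (Set.range f) := ⟨_, Set.forall_mem_range.2 hfg⟩
  have hgf (i : ι) : g i ≤ (⨆ j, f j) + C := by
    linarith [le_ciSup hf i, (abs_le.1 (h i)).1]
  rw [abs_le]
  constructor <;> linarith [ciSup_le hfg, ciSup_le hgf]

/-- Integrals of two functions at uniform distance at most `C` against a probability measure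
differ by at most `C`. -/
theorem abs_integral_sub_integral_le {Ω : Type*} [MeasurableSpace Ω] {μ : Measure Ω}
    [IsProbabilityMeasure μ] {f g : Ω → ℝ} {C : ℝ} (hf : Integrable f μ) (hg : Integrable g μ)
    (h : ∀ ω, |f ω - g ω| ≤ C) : |(∫ ω, f ω ∂μ) - ∫ ω, g ω ∂μ| ≤ C := by
  rw [← integral_sub hf hg]
  simpa using norm_integral_le_of_norm_le_const (μ := μ) (f := fun ω => f ω - g ω)
    (Filter.Eventually.of_forall h)

/-- Lemma 2 of the QDQ paper: under the event hypothesis, the Bellman residual of the QDQ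
operator at any bounded `Q` exceeds the classical Bellman residual by at most
`γ (1-α)(1-β) ⨆ x, |Q x|`, pointwise in `(s,a)`. -/
theorem qdq_residual_le_classical_residual_add {S A : Type*}
    [MeasurableSpace S] [MeasurableSpace A] [Nonempty S] [Nonempty A]
    (r : S × A → ℝ) (γ : ℝ) (hγ : γ ∈ Set.Ioo (0 : ℝ) 1)
    (κ : Kernel (S × A) S) [IsMarkovKernel κ]
    (α β : ℝ) (hα : α ∈ Set.Icc (0 : ℝ) 1) (hβ : β ∈ Set.Icc (0 : ℝ) 1)
    (U : Set (S × A)) (H : S × A → ℝ) (hH : ∀ x ∈ U, 0 < H x)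
    (Q : S × A → ℝ) (M : ℝ) (hQ : ∀ x, |Q x| ≤ M)
    (hint : ∀ p : S × A, Integrable (fun s' => ⨆ a' : A, Q (s', a')) (κ p))
    (hintG : ∀ p : S × A,
      Integrable (fun s' => ⨆ a' : A, blendedTarget U H α β Q (s', a')) (κ p))
    (hevent : ∀ x ∈ U, |1 - 1 / H x| * |Q x| ≤ (1 - β) * ⨆ y : S × A, |Q y|) :
    ∀ p : S × A,
      |Q p - qdqBellman r γ κ U H α β Q p| ≤
        |Q p - classicalBellman r γ κ Q p| +
          γ * (1 - α) * (1 - β) * ⨆ x : S × A, |Q x| := by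
  intro p
  have hbdd : BddAbove (Set.range fun x => |Q x|) := ⟨M, Set.forall_mem_range.2 hQ⟩
  have htarget (x : S × A) :
      |blendedTarget U H α β Q x - Q x| ≤ (1 - α) * ((1 - β) * ⨆ y, |Q y|) := by
    refine abs_blendedTarget_sub_le hα.2 (hevent x) ?_
    rw [abs_of_nonneg (sub_nonneg.2 hβ.2)]
    exact mul_le_mul_of_nonneg_left (le_ciSup hbdd x) (sub_nonneg.2 hβ.2)
  have hintegral := abs_integral_sub_integral_le (hintG p) (hint p) fun s =>
    abs_ciSup_sub_ciSup_le ⟨M, Set.forall_mem_range.2 fun a => (le_abs_self _).trans (hQ (s, a))⟩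
      fun a => htarget (s, a)
  have hbellman : |classicalBellman r γ κ Q p - qdqBellman r γ κ U H α β Q p| ≤
      γ * ((1 - α) * ((1 - β) * ⨆ y, |Q y|)) := by
    rw [abs_sub_comm, qdqBellman, classicalBellman, add_sub_add_left_eq_sub, ← mul_sub, abs_mul,
      abs_of_pos hγ.1]
    exact mul_le_mul_of_nonneg_left hintegral hγ.1.le
  calc |Q p - qdqBellman r γ κ U H α β Q p|
      ≤ |Q p - classicalBellman r γ κ Q p| +
          |classicalBellman r γ κ Q p - qdqBellman r γ κ U H α β Q p| := abs_sub_le _ _ _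
    _ ≤ |Q p - classicalBellman r γ κ Q p| + γ * ((1 - α) * ((1 - β) * ⨆ y, |Q y|)) :=
        add_le_add_right hbellman _
    _ = _ := by ring
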